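/- arXiv:1003.0412 — 2 statements merged into one kernel-verified Lean document; each statement's English description precedes it below -/
import Mathlib

section
/- Let k be a field and V a k-vector space of dimension 2n (n ≥ 2) with a nondegenerate alternating bilinear form (,). Let V_* = (0 = V_0 ⊂ V_1 ⊂ … ⊂ V_{2n} = V) be a complete isotropic flag, let p_* = (p_1 ≥ … ≥ p_σ) ∈ 𝒫_n, and let g be a unipotent isometry of V such that (g, V_*) satisfies the w_{p_*}-relative position conditions. Then, with N := g − 1, for every integer k ≥ 0 one has dim N^k(V) ≥ Σ_{r=1}^{σ} max(2p_r − k, 0). -/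
section

variable {k V : Type*} [Field k] [AddCommGroup V] [Module k V]

/-- For a bilinear form `B` and a subspace `X`, the perpendicular subspace
`X^⊥ = {y ∈ V : B(y,x) = 0 for all x ∈ X}`. -/
def perpSub (B : V →ₗ[k] V →ₗ[k] k) (X : Submodule k V) : Submodule k V where
  carrier := {y | ∀ x ∈ X, B y x = 0}
  add_mem' := by
    intro a b ha hb
    simp only [Set.mem_setOf_eq] at *
    intro x hx
    rw [map_add, LinearMap.add_apply, ha x hx, hb x hx, add_zero]
  zero_mem' := by
    simp only [Set.mem_setOf_eq]
    intro x hx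
    rw [map_zero, LinearMap.zero_apply]
  smul_mem' := by
    intro c a ha
    simp only [Set.mem_setOf_eq] at *
    intro x hx
    rw [map_smul, LinearMap.smul_apply, ha x hx, smul_zero]

/-- `p_{≤r} = p_1 + … + p_r` (so `partialSum p (r-1) = p_{<r}`). -/
def partialSum (p : ℕ → ℕ) (r : ℕ) : ℕ := ∑ t ∈ Finset.Icc 1 r, p t

/-- `p` represents a sequence `p_1 ≥ p_2 ≥ … ≥ p_σ` of integers `≥ 1` with sum `n`. -/
def IsPartitionOf (n σ : ℕ) (p : ℕ → ℕ) : Prop :=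
  1 ≤ σ ∧ (∀ t ∈ Finset.Icc 1 σ, 1 ≤ p t) ∧
    (∀ i j, 1 ≤ i → i ≤ j → j ≤ σ → p j ≤ p i) ∧ (∑ t ∈ Finset.Icc 1 σ, p t) = n

/-- The `w_{p_*}`-relative position conditions for `(g, V_*)`, where `W i = V_i` is a complete
flag in a space of dimension `D` and `V'_i = g V_i` : for every `r ∈ [1,σ]`,
`dim(V'_{p_{<r}+i} ∩ V_{p_{<r}+i}) = p_{<r}+i−r` and
`dim(V'_{p_{<r}+i} ∩ V_{p_{<r}+i+1}) = p_{<r}+i−r+1` for `i ∈ [1, p_r − 1]`, and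
`dim(V'_{p_{≤r}} ∩ V_{D−p_{<r}−1}) = p_{≤r}−r`, `dim(V'_{p_{≤r}} ∩ V_{D−p_{<r}}) = p_{≤r}−r+1`. -/
def RelPos (g : V ≃ₗ[k] V) (W : ℕ → Submodule k V) (σ : ℕ) (p : ℕ → ℕ) (D : ℕ) : Prop :=
  ∀ r ∈ Finset.Icc 1 σ,
    (∀ i ∈ Finset.Icc 1 (p r - 1),
      Module.finrank k
          ↥(Submodule.map g.toLinearMap (W (partialSum p (r - 1) + i))
              ⊓ W (partialSum p (r - 1) + i))
        = partialSum p (r - 1) + i - r ∧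
      Module.finrank k
          ↥(Submodule.map g.toLinearMap (W (partialSum p (r - 1) + i))
              ⊓ W (partialSum p (r - 1) + i + 1))
        = partialSum p (r - 1) + i - r + 1) ∧
    Module.finrank k
        ↥(Submodule.map g.toLinearMap (W (partialSum p r)) ⊓ W (D - partialSum p (r - 1) - 1))
      = partialSum p r - r ∧
    Module.finrank k
        ↥(Submodule.map g.toLinearMap (W (partialSum p r)) ⊓ W (D - partialSum p (r - 1)))
      = partialSum p r - r + 1



theorem triCore {ι : Type*} (s : Finset ι) (e : ι → V) (f : ι → V →ₗ[k] k) (ρ₁ ρ₂ : ι → ℤ)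
    (hd : ∀ i ∈ s, f i (e i) ≠ 0)
    (ht : ∀ i ∈ s, ∀ j ∈ s, j ≠ i → f i (e j) ≠ 0 → ρ₁ i < ρ₁ j ∨ (ρ₁ i = ρ₁ j ∧ ρ₂ i < ρ₂ j))
    (c : ι → k) (hc : ∀ i ∈ s, f i (∑ j ∈ s, c j • e j) = 0) : ∀ i ∈ s, c i = 0 := by
  classical
  by_contra! hcon
  obtain ⟨i0, hi0, hci0⟩ := hcon
  obtain ⟨i, hi, hmax⟩ := Finset.exists_max_image (s.filter fun i => c i ≠ 0)
    (fun i => toLex (ρ₁ i, ρ₂ i)) ⟨i0, by simp [hi0, hci0]⟩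
  simp only [Finset.mem_filter] at hi hmax
  have h := hc i hi.1
  rw [map_sum, Finset.sum_eq_single i] at h
  · rw [map_smul, smul_eq_mul] at h
    exact (mul_ne_zero hi.2 (hd i hi.1)) h
  · intro j hj hji
    rw [map_smul, smul_eq_mul]
    by_contra hne
    have h1 := left_ne_zero_of_mul hne
    have h2 := right_ne_zero_of_mul hne
    have h3 := hmax j ⟨hj, h1⟩
    have h4 := ht i hi.1 j hj hji h2
    rw [Prod.Lex.toLex_le_toLex] at h3
    simp only at h3
    omega
  · intro h; exact absurd hi.1 h

theorem triC [FiniteDimensional k V] {ι : Type*} (s : Finset ι) (e : ι → V) (f : ι → V →ₗ[k] k)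
    (ρ₁ ρ₂ : ι → ℤ)
    (hd : ∀ i ∈ s, f i (e i) ≠ 0)
    (ht : ∀ i ∈ s, ∀ j ∈ s, j ≠ i → f i (e j) ≠ 0 → ρ₁ i < ρ₁ j ∨ (ρ₁ i = ρ₁ j ∧ ρ₂ i < ρ₂ j))
    (X M : Submodule k V) (hXM : X ≤ M) (he : ∀ i ∈ s, e i ∈ M)
    (hX : ∀ i ∈ s, ∀ x ∈ X, f i x = 0) :
    Module.finrank k X + s.card ≤ Module.finrank k M := by
  classical
  have hli : LinearIndepOn k e (s : Set ι) := by
    rw [linearIndepOn_finset_iff]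
    intro c hc
    exact triCore s e f ρ₁ ρ₂ hd ht c (by intro i _; rw [hc, map_zero])
  have hcard : Module.finrank k (Submodule.span k (e '' (s : Set ι))) = s.card := by
    have := finrank_span_eq_card (R := k) hli
    rw [Set.image_eq_range]
    simpa using this
  have hdis : X ⊓ Submodule.span k (e '' (s : Set ι)) = ⊥ := by
    rw [eq_bot_iff]
    rintro x ⟨hx1, hx2⟩
    rw [SetLike.mem_coe, Submodule.mem_span_image_finset_iff_exists_fun] at hx2
    obtain ⟨c', rfl⟩ := hx2
    obtain ⟨c, rfl⟩ : ∃ c : ι → k, c' = fun i => c i.1 :=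
      ⟨fun i => if h : i ∈ s then c' ⟨i, h⟩ else 0, by ext i; simp⟩
    have hsum : ∑ i : s, c i.1 • e i.1 = ∑ i ∈ s, c i • e i :=
      Finset.sum_coe_sort s (fun i => c i • e i)
    change ∑ i : s, c i.1 • e i.1 ∈ _ at hx1
    change ∑ i : s, c i.1 • e i.1 ∈ _
    rw [hsum] at hx1 ⊢
    have := triCore s e f ρ₁ ρ₂ hd ht c (fun i hi => hX i hi _ hx1)
    rw [Submodule.mem_bot]
    exact Finset.sum_eq_zero fun i hi => by rw [this i hi, zero_smul]
  have h := Submodule.finrank_sup_add_finrank_inf_eq X (Submodule.span k (e '' (s : Set ι)))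
  rw [hdis, finrank_bot, hcard] at h
  have h2 : X ⊔ Submodule.span k (e '' (s : Set ι)) ≤ M := by
    refine sup_le hXM (Submodule.span_le.2 ?_)
    rintro _ ⟨i, hi, rfl⟩
    exact he i hi
  have := Submodule.finrank_mono h2
  omega

theorem card_le_of_linearIndepOn [FiniteDimensional k V] {ι : Type*} (s : Finset ι) (e : ι → V)
    (hli : LinearIndepOn k e (s : Set ι)) (M : Submodule k V) (he : ∀ i ∈ s, e i ∈ M) :
    s.card ≤ Module.finrank k M := by
  have hcard : Module.finrank k (Submodule.span k (e '' (s : Set ι))) = s.card := by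
    have := finrank_span_eq_card (R := k) hli
    rw [Set.image_eq_range]
    simpa using this
  rw [← hcard]
  apply Submodule.finrank_mono
  refine (Submodule.span_le.2 ?_)
  rintro _ ⟨i, hi, rfl⟩
  exact he i hi

theorem exists_coord {ι : Type*} (s : Set ι) (e : ι → V)
    (hli : LinearIndepOn k e s) (i : ι) (hi : i ∈ s) :
    ∃ f : V →ₗ[k] k, f (e i) = 1 ∧ ∀ j ∈ s, j ≠ i → f (e j) = 0 := by
  classical
  let i' : s := ⟨i, hi⟩
  obtain ⟨f, hf⟩ := LinearMap.exists_extend ((Finsupp.lapply i') ∘ₗ (LinearIndependent.repr hli))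
  have key : ∀ j : s, f (e j) = Finsupp.single j (1 : k) i' := by
    intro j
    have h1 := LinearIndependent.repr_eq_single hli j
      ⟨e j, Submodule.subset_span ⟨j, rfl⟩⟩ rfl
    have h2 := LinearMap.congr_fun hf ⟨e j, Submodule.subset_span ⟨j, rfl⟩⟩
    rw [LinearMap.comp_apply, LinearMap.comp_apply] at h2
    erw [h1] at h2
    exact h2
  refine ⟨f, ?_, ?_⟩
  · rw [key i']; simp
  · intro j hj hji
    rw [key ⟨j, hj⟩, Finsupp.single_apply, if_neg]
    intro h; apply hji; exact congrArg Subtype.val h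

/-- index set -/
noncomputable def idx (σ : ℕ) (a b : ℕ → ℤ) : Finset (Σ _ : ℕ, ℤ) :=
  (Finset.Icc 1 σ).sigma fun t => Finset.Ico (a t) (b t)

theorem diffStep (σ : ℕ) (a b : ℕ → ℤ) (x : ℕ → ℤ → V)
    (h : LinearIndepOn k (fun i : (Σ _ : ℕ, ℤ) => x i.1 i.2) (idx σ a b : Set (Σ _ : ℕ, ℤ))) :
    LinearIndepOn k (fun i : (Σ _ : ℕ, ℤ) => x i.1 (i.2 + 1) - x i.1 i.2)
      (idx σ a (fun t => b t - 1) : Set (Σ _ : ℕ, ℤ)) := by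
  classical
  have hex : ∀ i : (Σ _ : ℕ, ℤ), ∃ f : V →ₗ[k] k, i ∈ idx σ a (fun t => b t - 1) →
      f (x i.1 (i.2 + 1)) = 1 ∧ ∀ j ∈ idx σ a b, j ≠ ⟨i.1, i.2 + 1⟩ → f (x j.1 j.2) = 0 := by
    intro i
    by_cases hi : i ∈ idx σ a (fun t => b t - 1)
    · obtain ⟨f, h1, h2⟩ := exists_coord _ _ h ⟨i.1, i.2 + 1⟩
        (by simp [idx] at hi ⊢; omega)
      exact ⟨f, fun _ => ⟨h1, fun j hj => h2 j hj⟩⟩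
    · exact ⟨0, fun h => absurd h hi⟩
  choose f hf using hex
  have key : ∀ i ∈ idx σ a (fun t => b t - 1), ∀ j ∈ idx σ a (fun t => b t - 1),
      f i (x j.1 (j.2 + 1)) = (if j = i then 1 else 0) ∧
      f i (x j.1 j.2) = (if j = ⟨i.1, i.2 + 1⟩ then 1 else 0) := by
    intro i hi j hj
    obtain ⟨h1, h2⟩ := hf i hi
    constructor
    · split_ifs with hji
      · rw [hji, h1]
      · apply h2 ⟨j.1, j.2 + 1⟩
        · simp [idx] at hj ⊢; omega
        · intro hc; apply hji
          rcases i with ⟨i1, i2⟩; rcases j with ⟨j1, j2⟩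
          simp at hc ⊢; exact hc
    · split_ifs with hji
      · rw [hji, h1]
      · apply h2 j _ hji
        simp [idx] at hj ⊢; omega
  rw [linearIndepOn_finset_iff]
  intro c hc
  refine triCore _ _ f (fun i => i.2) (fun _ => 0) ?_ ?_ c (by intro i _; rw [hc, map_zero])
  · intro i hi
    have := key i hi i hi
    rw [map_sub, this.1, this.2, if_pos rfl, if_neg, sub_zero]
    · exact one_ne_zero
    · rcases i with ⟨i1, i2⟩
      simp
  · intro i hi j hj hji hne
    have := key i hi j hj
    rw [map_sub, this.1, this.2, if_neg hji] at hne
    by_cases hh : j = ⟨i.1, i.2 + 1⟩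
    · left; rw [hh]; simp
    · rw [if_neg hh] at hne; simp at hne

theorem partialSum_succ (p : ℕ → ℕ) (r : ℕ) : partialSum p (r + 1) = partialSum p r + p (r + 1) := by
  unfold partialSum
  rw [Finset.sum_Icc_succ_top (by omega)]

theorem partialSum_mono (p : ℕ → ℕ) {a b : ℕ} (h : a ≤ b) : partialSum p a ≤ partialSum p b := by
  induction b, h using Nat.le_induction with
  | base => exact le_rfl
  | succ b _ ih => rw [partialSum_succ]; omega

theorem partialSum_pred (p : ℕ → ℕ) {t : ℕ} (h : 1 ≤ t) :
    partialSum p (t - 1) + p t = partialSum p t := by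
  obtain ⟨t, rfl⟩ : ∃ u, t = u + 1 := ⟨t - 1, by omega⟩
  rw [partialSum_succ]; rfl

theorem partialSum_lt (p : ℕ → ℕ) {s t : ℕ} (hs : 1 ≤ s) (h : s < t) :
    partialSum p (s - 1) + p s ≤ partialSum p (t - 1) := by
  rw [partialSum_pred p hs]; exact partialSum_mono p (by omega)

/-- Vectors adapted to the flag. -/
structure Gram (B : V →ₗ[k] V →ₗ[k] k) (g : V ≃ₗ[k] V) (p : ℕ → ℕ) (r : ℕ) (v : ℕ → V) : Prop where
  lt : ∀ s t, 1 ≤ s → s < t → t ≤ r → ∀ m : ℤ, -(p s : ℤ) < m → m ≤ p s → B (v s) ((g ^ m) (v t)) = 0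
  eq : ∀ t, 1 ≤ t → t ≤ r → ∀ m : ℤ, -(p t : ℤ) < m → m < p t → B (v t) ((g ^ m) (v t)) = 0
  pos : ∀ t, 1 ≤ t → t ≤ r → B (v t) ((g ^ (p t : ℤ)) (v t)) ≠ 0
  neg : ∀ t, 1 ≤ t → t ≤ r → B (v t) ((g ^ (-(p t : ℤ))) (v t)) ≠ 0
  gt : ∀ s t, 1 ≤ t → t < s → s ≤ r → ∀ m : ℤ, -(p t : ℤ) ≤ m → m < p t → B (v s) ((g ^ m) (v t)) = 0

structure Good (B : V →ₗ[k] V →ₗ[k] k) (g : V ≃ₗ[k] V) (W : ℕ → Submodule k V)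
    (p : ℕ → ℕ) (r : ℕ) (v : ℕ → V) : Prop where
  mem : ∀ t, 1 ≤ t → t ≤ r → ∀ j : ℕ, j < p t →
    (g ^ (j : ℤ)) (v t) ∈ W (partialSum p (t - 1) + j + 1)
  nmem : ∀ t, 1 ≤ t → t ≤ r → ∀ j : ℕ, j < p t →
    (g ^ (j : ℤ)) (v t) ∉ W (partialSum p (t - 1) + j)
  orth : ∀ s t, 1 ≤ s → s < t → t ≤ r → ∀ i : ℤ, 1 ≤ i → i ≤ p s →
    B (v s) ((g ^ i) (v t)) = 0
  diag : ∀ t, 1 ≤ t → t ≤ r → B (v t) ((g ^ (p t : ℤ)) (v t)) ≠ 0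

theorem zpow_isom (B : V →ₗ[k] V →ₗ[k] k) (g : V ≃ₗ[k] V)
    (hg : ∀ x y : V, B (g x) (g y) = B x y) (m : ℤ) :
    ∀ x y, B ((g ^ m) x) ((g ^ m) y) = B x y := by
  induction m using Int.induction_on with
  | zero => intro x y; simp
  | succ i ih => intro x y; rw [zpow_add_one]; simp only [LinearEquiv.mul_apply]; rw [ih, hg]
  | pred i ih =>
    intro x y
    rw [← ih x y]
    have h : g ^ (-(i : ℤ)) = g * g ^ (-(i : ℤ) - 1) := by
      rw [← zpow_one_add]; congr 1; ring
    rw [h]; simp only [LinearEquiv.mul_apply]; rw [hg]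

theorem zpow_zpow_apply (g : V ≃ₗ[k] V) (a b c : ℤ) (h : a + b = c) (x : V) :
    (g ^ a) ((g ^ b) x) = (g ^ c) x := by
  rw [← h, zpow_add, LinearEquiv.mul_apply]

theorem zpow_pair (B : V →ₗ[k] V →ₗ[k] k) (g : V ≃ₗ[k] V)
    (hg : ∀ x y : V, B (g x) (g y) = B x y) (a b : ℤ) (x y : V) :
    B ((g ^ a) x) ((g ^ b) y) = B x ((g ^ (b - a)) y) := by
  rw [← zpow_isom B g hg a x, zpow_zpow_apply g a (b - a) b (by ring)]

theorem skew (B : V →ₗ[k] V →ₗ[k] k) (halt : ∀ x : V, B x x = 0) (x y : V) :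
    B x y = - B y x := by
  have h := halt (x + y)
  simp only [map_add, LinearMap.add_apply, halt, zero_add, add_zero] at h
  exact eq_neg_of_add_eq_zero_right h

theorem Good.gram {B : V →ₗ[k] V →ₗ[k] k} {g : V ≃ₗ[k] V} {W : ℕ → Submodule k V}
    {p : ℕ → ℕ} {r : ℕ} {v : ℕ → V} (h : Good B g W p r v) {n : ℕ}
    (halt : ∀ x : V, B x x = 0)
    (hg : ∀ x y : V, B (g x) (g y) = B x y)
    (hiso : ∀ x ∈ W n, ∀ y ∈ W n, B x y = 0)
    (hWmono : ∀ i j, i ≤ j → j ≤ 2 * n → W i ≤ W j)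
    (hr : partialSum p r ≤ n) (hp1 : ∀ t, 1 ≤ t → t ≤ r → 1 ≤ p t) : Gram B g p r v := by
  have hmem : ∀ t, 1 ≤ t → t ≤ r → ∀ j : ℤ, 0 ≤ j → j < p t → (g ^ j) (v t) ∈ W n := by
    intro t ht htr j hj hjp
    lift j to ℕ using hj
    have h1 := partialSum_pred p ht
    have h2 := partialSum_mono p htr
    exact hWmono _ n (by omega) (by omega) (h.mem t ht htr j (by omega))
  have hmem0 : ∀ t, 1 ≤ t → t ≤ r → v t ∈ W n := by
    intro t ht htr
    have := hmem t ht htr 0 le_rfl (by have := hp1 t ht htr; omega)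
    simpa using this
  have hneg : ∀ s t (m : ℤ), B (v s) ((g ^ m) (v t)) = B ((g ^ (-m)) (v s)) (v t) := by
    intro s t m
    have := zpow_pair B g hg (-m) 0 (v s) (v t)
    rw [sub_neg_eq_add, zero_add] at this
    exact this.symm
  have hlt : ∀ s t, 1 ≤ s → s < t → t ≤ r → ∀ m : ℤ, -(p s : ℤ) < m → m ≤ p s →
      B (v s) ((g ^ m) (v t)) = 0 := by
    intro s t hs hst ht m h1 h2
    rcases lt_or_ge 0 m with hm | hm
    · exact h.orth s t hs hst ht m (by omega) h2
    · rw [hneg]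
      exact hiso _ (hmem s hs (by omega) _ (by omega) (by omega)) _ (hmem0 t (by omega) ht)
  refine ⟨hlt, ?_, h.diag, ?_, ?_⟩
  · intro t ht htr m h1 h2
    rcases lt_or_ge 0 m with hm | hm
    · exact hiso _ (hmem0 t ht htr) _ (hmem t ht htr _ (by omega) (by omega))
    · rw [hneg]
      exact hiso _ (hmem t ht htr _ (by omega) (by omega)) _ (hmem0 t ht htr)
  · intro t ht htr
    rw [hneg, skew B halt, neg_neg]
    exact neg_ne_zero.2 (h.diag t ht htr)
  · intro s t ht hts hs m h1 h2
    rw [hneg, skew B halt, hlt t s ht hts hs (-m) (by omega) (by omega), neg_zero]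

section
variable {B : V →ₗ[k] V →ₗ[k] k} {g : V ≃ₗ[k] V} {p : ℕ → ℕ} {r : ℕ} {v : ℕ → V}

theorem Gram.posPair (h : Gram B g p r v)
    (hg : ∀ x y : V, B (g x) (g y) = B x y)
    (hanti : ∀ i j, 1 ≤ i → i ≤ j → j ≤ r → p j ≤ p i)
    (s t : ℕ) (a b : ℤ) (hs : 1 ≤ s) (hsr : s ≤ r) (ht : 1 ≤ t) (htr : t ≤ r)
    (ha0 : 0 ≤ a) (ha : a < p s) (hb0 : -(p t : ℤ) ≤ b) (hb : b < p t)
    (hne : B ((g ^ (a - (p s : ℤ))) (v s)) ((g ^ b) (v t)) ≠ 0) :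
    a < b ∨ (a = b ∧ t ≤ s) := by
  rw [zpow_pair B g hg] at hne
  by_contra hcon
  apply hne
  rcases lt_trichotomy s t with hst | rfl | hst
  · have := hanti s t hs hst.le htr
    exact h.lt s t hs hst htr _ (by omega) (by omega)
  · exact h.eq s hs hsr _ (by omega) (by omega)
  · have := hanti t s ht hst.le hsr
    exact h.gt s t ht hst hsr _ (by omega) (by omega)

theorem Gram.negPair (h : Gram B g p r v)
    (hg : ∀ x y : V, B (g x) (g y) = B x y)
    (hanti : ∀ i j, 1 ≤ i → i ≤ j → j ≤ r → p j ≤ p i)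
    (s t : ℕ) (a b : ℤ) (hs : 1 ≤ s) (hsr : s ≤ r) (ht : 1 ≤ t) (htr : t ≤ r)
    (ha0 : -(p s : ℤ) ≤ a) (ha : a < 0) (hb0 : -(p t : ℤ) ≤ b) (hb : b < 0)
    (hne : B ((g ^ (a + (p s : ℤ))) (v s)) ((g ^ b) (v t)) ≠ 0) :
    b < a ∨ (a = b ∧ s ≤ t) := by
  rw [zpow_pair B g hg] at hne
  by_contra hcon
  apply hne
  rcases lt_trichotomy s t with hst | rfl | hst
  · have := hanti s t hs hst.le htr
    exact h.lt s t hs hst htr _ (by omega) (by omega)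
  · exact h.eq s hs hsr _ (by omega) (by omega)
  · have := hanti t s ht hst.le hsr
    exact h.gt s t ht hst hsr _ (by omega) (by omega)

theorem Gram.indep (h : Gram B g p r v)
    (hg : ∀ x y : V, B (g x) (g y) = B x y)
    (hanti : ∀ i j, 1 ≤ i → i ≤ j → j ≤ r → p j ≤ p i) :
    LinearIndepOn k (fun i : (Σ _ : ℕ, ℤ) => (g ^ i.2) (v i.1))
      (idx r (fun t => -(p t : ℤ)) (fun t => p t) : Set (Σ _ : ℕ, ℤ)) := by
  rw [linearIndepOn_finset_iff]
  intro c hc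
  refine triCore _ _ (fun i => if 0 ≤ i.2 then B ((g ^ (i.2 - (p i.1 : ℤ))) (v i.1))
      else B ((g ^ (i.2 + (p i.1 : ℤ))) (v i.1)))
    (fun i => if 0 ≤ i.2 then i.2 + p 1 else -1 - i.2)
    (fun i => if 0 ≤ i.2 then - (i.1 : ℤ) else i.1) ?_ ?_ c (by intro i _; rw [hc, map_zero])
  · rintro ⟨t, j⟩ hi
    simp only [idx, Finset.mem_sigma, Finset.mem_Icc, Finset.mem_Ico] at hi
    dsimp only
    split_ifs with hj
    · rw [zpow_pair B g hg]
      convert h.pos t hi.1.1 hi.1.2 using 5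
      ring
    · rw [zpow_pair B g hg]
      convert h.neg t hi.1.1 hi.1.2 using 5
      ring
  · rintro ⟨s, a⟩ hi ⟨t, b⟩ hj hne
    simp only [idx, Finset.mem_sigma, Finset.mem_Icc, Finset.mem_Ico] at hi hj
    have hne' : ¬ (t = s ∧ b = a) := by rintro ⟨rfl, rfl⟩; exact hne rfl
    dsimp only
    have hs1 := hanti 1 s le_rfl hi.1.1 hi.1.2
    have ht1 := hanti 1 t le_rfl hj.1.1 hj.1.2
    intro hB
    by_cases ha : 0 ≤ a
    · rw [if_pos ha] at hB
      have := h.posPair hg hanti s t a b hi.1.1 hi.1.2 hj.1.1 hj.1.2 ha hi.2.2 hj.2.1 hj.2.2 hB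
      have hb : 0 ≤ b := by omega
      simp only [ha, hb, if_true]
      omega
    · rw [if_neg ha] at hB
      by_cases hb : 0 ≤ b
      · simp only [ha, hb, if_true, if_false]
        omega
      · have := h.negPair hg hanti s t a b hi.1.1 hi.1.2 hj.1.1 hj.1.2 hi.2.1 (by omega)
          hj.2.1 (by omega) hB
        simp only [ha, hb, if_false]
        omega

theorem Gram.final [FiniteDimensional k V] (h : Gram B g p r v)
    (hg : ∀ x y : V, B (g x) (g y) = B x y)
    (hanti : ∀ i j, 1 ≤ i → i ≤ j → j ≤ r → p j ≤ p i) (K : ℕ) :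
    ∑ t ∈ Finset.Icc 1 r, (2 * p t - K) ≤
        Module.finrank k
          (LinearMap.range ((g.toLinearMap - LinearMap.id : Module.End k V) ^ K)) := by
  set N : Module.End k V := g.toLinearMap - LinearMap.id with hN
  have hind : LinearIndepOn k (fun i : (Σ _ : ℕ, ℤ) => (N ^ K) ((g ^ i.2) (v i.1)))
      (idx r (fun t => -(p t : ℤ)) (fun t => p t - K) : Set (Σ _ : ℕ, ℤ)) := by
    induction K with
    | zero => simpa using h.indep hg hanti
    | succ K ih =>
      have := diffStep r _ _ (fun t j => (N ^ K) ((g ^ j) (v t))) ih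
      convert this using 1
      · ext i
        rw [pow_succ, Module.End.mul_apply, ← map_sub]
        congr 1
        rw [hN, LinearMap.sub_apply, LinearMap.id_apply]
        congr 1
        rw [add_comm, zpow_one_add]
        rfl
      · congr 2
        ext t
        push_cast; ring
  have := card_le_of_linearIndepOn _ _ hind (LinearMap.range (N ^ K)) (fun i _ => ⟨_, rfl⟩)
  refine le_trans (le_of_eq ?_) this
  rw [idx, Finset.card_sigma]
  refine Finset.sum_congr rfl fun t _ => ?_
  rw [Int.card_Ico]
  omega

/-- Lemma F -/
theorem Gram.memOf [FiniteDimensional k V] (h : Gram B g p r v)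
    (hanti : ∀ i j, 1 ≤ i → i ≤ j → j ≤ r → p j ≤ p i) (hp1 : ∀ t, 1 ≤ t → t ≤ r → 1 ≤ p t) (M Y : Submodule k V) (x : V)
    (hM : ∀ t, 1 ≤ t → t ≤ r → (g ^ (p t : ℤ)) (v t) ∈ M) (hxM : x ∈ M)
    (hx : ∀ t, 1 ≤ t → t ≤ r → B (v t) x = 0)
    (hY : ∀ t, 1 ≤ t → t ≤ r → ∀ y ∈ Y, B (v t) y = 0)
    (hdim : Module.finrank k M ≤ Module.finrank k ↥(M ⊓ Y) + r) : x ∈ Y := by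
  have key := triC (Finset.Icc 1 r) (fun t => (g ^ (p t : ℤ)) (v t)) (fun t => B (v t))
    (fun t => - (t : ℤ)) (fun _ => 0)
    (by intro t ht; rw [Finset.mem_Icc] at ht; exact h.pos t ht.1 ht.2)
    (by
      intro s hs t ht hne hB
      rw [Finset.mem_Icc] at hs ht
      left
      by_contra hcon
      have hst : s < t := by omega
      have := hanti s t hs.1 hst.le ht.2
      have := h.pos s hs.1 hs.2
      have hps : (0 : ℤ) ≤ p t := by omega
      have := hp1 s hs.1 hs.2
      exact hB (h.lt s t hs.1 hst ht.2 _ (by omega) (by omega)))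
    ((M ⊓ Y) ⊔ Submodule.span k {x}) M
    (sup_le inf_le_left (by rw [Submodule.span_singleton_le_iff_mem]; exact hxM))
    (by intro t ht; rw [Finset.mem_Icc] at ht; exact hM t ht.1 ht.2)
    (by
      intro t ht y hy
      rw [Finset.mem_Icc] at ht
      have : (M ⊓ Y) ⊔ Submodule.span k {x} ≤ LinearMap.ker (B (v t)) := by
        refine sup_le (fun y hy => hY t ht.1 ht.2 y hy.2) ?_
        rw [Submodule.span_singleton_le_iff_mem]; exact hx t ht.1 ht.2
      exact this hy)
  rw [Nat.card_Icc] at key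
  have heq := Submodule.eq_of_le_of_finrank_le
    (le_sup_left : M ⊓ Y ≤ (M ⊓ Y) ⊔ Submodule.span k {x}) (by omega)
  have : x ∈ (M ⊓ Y) ⊔ Submodule.span k {x} :=
    Submodule.mem_sup_right (Submodule.mem_span_singleton_self x)
  rw [← heq] at this
  exact this.2

end

/-- Lemma E -/
theorem flagCount [FiniteDimensional k V] (g : V ≃ₗ[k] V) (W : ℕ → Submodule k V) (n : ℕ)
    (hWmono : ∀ i j, i ≤ j → j ≤ 2 * n → W i ≤ W j)
    (p : ℕ → ℕ) (r i : ℕ) (v : ℕ → V) (hp1 : ∀ t, 1 ≤ t → t ≤ r + 1 → 1 ≤ p t)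
    (hi : i ≤ p (r + 1)) (hn : partialSum p (r + 1) ≤ n)
    (hmem : ∀ t, 1 ≤ t → t ≤ r + 1 → ∀ j : ℕ, j < p t → (t = r + 1 → j < i) →
      (g ^ (j : ℤ)) (v t) ∈ W (partialSum p (t - 1) + j + 1))
    (hnmem : ∀ t, 1 ≤ t → t ≤ r + 1 → ∀ j : ℕ, j < p t → (t = r + 1 → j < i) →
      (g ^ (j : ℤ)) (v t) ∉ W (partialSum p (t - 1) + j))
    (Y : Submodule k V)
    (hY : ∀ t, 1 ≤ t → t ≤ r → ∀ j : ℕ, j + 1 < p t → (g ^ ((j + 1 : ℕ) : ℤ)) (v t) ∈ Y)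
    (hYr : ∀ j : ℕ, j < i → (g ^ ((j + 1 : ℕ) : ℤ)) (v (r + 1)) ∈ Y) :
    partialSum p r + i ≤
      Module.finrank k ↥(Submodule.map g.toLinearMap (W (partialSum p r + i)) ⊓ Y) + r := by
  classical
  have hps := partialSum_succ p r
  let S : Finset (Σ _ : ℕ, ℕ) := (Finset.Icc 1 (r + 1)).sigma
    fun t => Finset.range (if t = r + 1 then i else p t - 1)
  have hS : ∀ x ∈ S, 1 ≤ x.1 ∧ x.1 ≤ r + 1 ∧ x.2 < p x.1 ∧ (x.1 = r + 1 → x.2 < i) ∧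
      (x.1 ≠ r + 1 → x.2 + 1 < p x.1) := by
    rintro ⟨t, j⟩ hx
    simp only [S, Finset.mem_sigma, Finset.mem_Icc, Finset.mem_range] at hx
    dsimp only
    have := hp1 t hx.1.1 hx.1.2
    by_cases ht : t = r + 1
    · subst ht; simp at hx; refine ⟨?_, ?_, ?_, ?_, ?_⟩ <;> omega
    · simp only [ht, if_false] at hx; omega
  have hcard : S.card + r = partialSum p r + i := by
    simp only [S, Finset.card_sigma, Finset.card_range]
    rw [Finset.sum_Icc_succ_top (by omega), if_pos rfl]
    have h1 : ∑ t ∈ Finset.Icc 1 r, (if t = r + 1 then i else p t - 1) + r = partialSum p r := by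
      have h2 : r = ∑ t ∈ Finset.Icc 1 r, 1 := by simp
      unfold partialSum
      refine (congrArg (_ + ·) h2).trans ?_
      rw [← Finset.sum_add_distrib]
      refine Finset.sum_congr rfl fun t ht => ?_
      rw [Finset.mem_Icc] at ht
      have := hp1 t ht.1 (by omega)
      rw [if_neg (by omega)]; omega
    omega
  have hex : ∀ x : (Σ _ : ℕ, ℕ), ∃ f : V →ₗ[k] k, x ∈ S →
      f ((g ^ (x.2 : ℤ)) (v x.1)) ≠ 0 ∧ ∀ y ∈ W (partialSum p (x.1 - 1) + x.2), f y = 0 := by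
    intro x
    by_cases hx : x ∈ S
    · obtain ⟨h1, h2, h3, h4, h5⟩ := hS x hx
      obtain ⟨f, hf1, hf2⟩ := Submodule.exists_le_ker_of_notMem (hnmem x.1 h1 h2 x.2 h3 h4)
      exact ⟨f, fun _ => ⟨hf1, fun y hy => hf2 hy⟩⟩
    · exact ⟨0, fun h => absurd h hx⟩
  choose f hf using hex
  have hgg : ∀ (j : ℕ) (x : V), g.symm ((g ^ ((j + 1 : ℕ) : ℤ)) x) = (g ^ (j : ℤ)) x := by
    intro j x
    rw [LinearEquiv.symm_apply_eq]
    push_cast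
    rw [add_comm, zpow_one_add]; rfl
  have key := triC S (fun x => (g ^ ((x.2 + 1 : ℕ) : ℤ)) (v x.1))
    (fun x => f x ∘ₗ g.symm.toLinearMap) (fun x => x.1) (fun x => x.2)
    (by
      intro x hx
      simp only [LinearMap.comp_apply, LinearEquiv.coe_coe, hgg]
      exact (hf x hx).1)
    (by
      rintro ⟨s, a⟩ hx ⟨t, b⟩ hy hne hB
      simp only [LinearMap.comp_apply, LinearEquiv.coe_coe, hgg] at hB
      dsimp only
      have hne' : ¬ (t = s ∧ b = a) := by rintro ⟨rfl, rfl⟩; exact hne rfl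
      by_contra hcon
      apply hB
      apply (hf ⟨s, a⟩ hx).2
      obtain ⟨h1, h2, h3, h4, h5⟩ := hS _ hx
      obtain ⟨h1', h2', h3', h4', h5'⟩ := hS _ hy
      dsimp only at *
      have hsn := partialSum_pred p h1
      have hsn' := partialSum_mono p h2
      refine hWmono _ _ ?_ ?_ (hmem t h1' h2' b h3' h4')
      · rcases lt_trichotomy s t with hst | rfl | hst
        · omega
        · omega
        · have := partialSum_lt p h1' hst
          omega
      · omega)
    ⊥ (Submodule.map g.toLinearMap (W (partialSum p r + i)) ⊓ Y) bot_le
    (by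
      rintro ⟨t, j⟩ hx
      obtain ⟨h1, h2, h3, h4, h5⟩ := hS _ hx
      dsimp only at *
      refine ⟨⟨(g ^ (j : ℤ)) (v t), ?_, ?_⟩, ?_⟩
      · refine hWmono _ _ ?_ ?_ (hmem t h1 h2 j h3 h4)
        · by_cases ht : t = r + 1
          · have := h4 ht; subst ht; simp only [Nat.add_sub_cancel]; omega
          · have := partialSum_lt p h1 (show t < r + 1 by omega)
            simp only [Nat.add_sub_cancel] at this; omega
        · omega
      · rw [← hgg]; simp
      · by_cases ht : t = r + 1
        · have := h4 ht; subst ht; exact hYr j this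
        · exact hY t h1 (by omega) j (h5 ht))
    (by intro x _ y hy; rw [Submodule.mem_bot] at hy; rw [hy, map_zero])
  rw [finrank_bot] at key
  omega

/-- existence of the first vector of the next block -/
theorem exists_next [FiniteDimensional k V] (B : V →ₗ[k] V →ₗ[k] k) (g : V ≃ₗ[k] V)
    (W : ℕ → Submodule k V) (n : ℕ)
    (hg : ∀ x y : V, B (g x) (g y) = B x y)
    (hWmono : ∀ i j, i ≤ j → j ≤ 2 * n → W i ≤ W j)
    (hWdim : ∀ i ≤ 2 * n, Module.finrank k ↥(W i) = i)
    (p : ℕ → ℕ) (r : ℕ) (v : ℕ → V) (hG : Good B g W p r v) (hGr : Gram B g p r v)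
    (hanti : ∀ i j, 1 ≤ i → i ≤ j → j ≤ r → p j ≤ p i)
    (hn : partialSum p r + 1 ≤ n) :
    ∃ x ∈ W (partialSum p r + 1), x ∉ W (partialSum p r) ∧
      ∀ s, 1 ≤ s → s ≤ r → ∀ i : ℤ, 1 ≤ i → i ≤ p s → B (v s) ((g ^ i) x) = 0 := by
  classical
  let S := idx r (fun _ => 0) (fun t => p t)
  have hS : ∀ x ∈ S, (1 ≤ x.1 ∧ x.1 ≤ r) ∧ 0 ≤ x.2 ∧ x.2 < p x.1 := by
    rintro ⟨t, j⟩ hx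
    simpa only [S, idx, Finset.mem_sigma, Finset.mem_Icc, Finset.mem_Ico] using hx
  have hcard : S.card = partialSum p r := by
    simp only [S, idx, Finset.card_sigma, Int.card_Ico, partialSum]
    refine Finset.sum_congr rfl fun t _ => ?_
    omega
  let F : W (partialSum p r + 1) →ₗ[k] (S → k) :=
    (LinearMap.pi fun x : S => B ((g ^ (x.1.2 - (p x.1.1 : ℤ))) (v x.1.1))) ∘ₗ
      (W (partialSum p r + 1)).subtype
  have hker : LinearMap.ker F ≠ ⊥ := by
    apply LinearMap.ker_ne_bot_of_finrank_lt
    rw [hWdim _ (by omega), Module.finrank_fintype_fun_eq_card, Fintype.card_coe, hcard]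
    omega
  obtain ⟨x, hx, hx0⟩ := Submodule.exists_mem_ne_zero_of_ne_bot hker
  have hxF : ∀ i ∈ S, B ((g ^ (i.2 - (p i.1 : ℤ))) (v i.1)) (x : V) = 0 := by
    intro i hi
    exact congrFun (LinearMap.mem_ker.1 hx) ⟨i, hi⟩
  refine ⟨x, x.2, ?_, ?_⟩
  · intro hxW
    have key := triC S (fun i => (g ^ i.2) (v i.1))
      (fun i => B ((g ^ (i.2 - (p i.1 : ℤ))) (v i.1))) (fun i => i.2) (fun i => -(i.1 : ℤ))
      (by
        rintro ⟨t, j⟩ hi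
        have h := hS _ hi
        dsimp only at *
        rw [zpow_pair B g hg]
        convert hGr.pos t h.1.1 h.1.2 using 5
        ring)
      (by
        rintro ⟨s, a⟩ hi ⟨t, b⟩ hj hne hB
        have h1 := hS _ hi
        have h2 := hS _ hj
        dsimp only at *
        have hne' : ¬ (t = s ∧ b = a) := by rintro ⟨rfl, rfl⟩; exact hne rfl
        have := hGr.posPair hg hanti s t a b h1.1.1 h1.1.2 h2.1.1 h2.1.2 h1.2.1 h1.2.2
          (by omega) h2.2.2 hB
        omega)
      (Submodule.span k {(x : V)}) (W (partialSum p r))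
      (by rw [Submodule.span_singleton_le_iff_mem]; exact hxW)
      (by
        rintro ⟨t, j⟩ hi
        have h := hS _ hi
        dsimp only at *
        obtain ⟨⟨h1, h2⟩, h3, h4⟩ := h
        lift j to ℕ using h3
        have h5 := partialSum_pred p h1
        have h6 := partialSum_mono p h2
        exact hWmono _ _ (by omega) (by omega) (hG.mem t h1 h2 j (by omega)))
      (by
        intro i hi y hy
        obtain ⟨c, rfl⟩ := Submodule.mem_span_singleton.1 hy
        rw [map_smul, hxF i hi, smul_zero])
    rw [hWdim _ (by omega), hcard, finrank_span_singleton (by simpa using hx0)] at key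
    omega
  · intro s hs hsr i hi1 hi2
    have h := hxF ⟨s, p s - i⟩ (by simp [S, idx]; omega)
    have h2 := zpow_pair B g hg ((p s - i) - (p s : ℤ)) 0 (v s) x
    rw [show (0 : ℤ) - ((p s - i) - (p s : ℤ)) = i by ring] at h2
    rw [← h2]
    exact h

theorem step [FiniteDimensional k V] (n σ : ℕ) (p : ℕ → ℕ)
    (hp : IsPartitionOf n σ p)
    (B : V →ₗ[k] V →ₗ[k] k)
    (halt : ∀ x : V, B x x = 0)
    (W : ℕ → Submodule k V)
    (hWmono : ∀ i j, i ≤ j → j ≤ 2 * n → W i ≤ W j)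
    (hWdim : ∀ i ≤ 2 * n, Module.finrank k ↥(W i) = i)
    (hWperp : ∀ i ≤ n, perpSub B (W i) = W (2 * n - i))
    (g : V ≃ₗ[k] V)
    (hg : ∀ x y : V, B (g x) (g y) = B x y)
    (hiso : ∀ x ∈ W n, ∀ y ∈ W n, B x y = 0)
    (hrel : RelPos g W σ p (2 * n)) (r : ℕ) (hr : r + 1 ≤ σ) (v₀ : ℕ → V)
    (hG : Good B g W p r v₀) : ∃ v, Good B g W p (r + 1) v := by
  classical
  obtain ⟨-, hp1, hanti, hsum⟩ := hp
  have hp1' : ∀ t, 1 ≤ t → t ≤ σ → 1 ≤ p t := fun t h1 h2 => hp1 t (Finset.mem_Icc.2 ⟨h1, h2⟩)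
  have hpr := hp1' (r + 1) (by omega) hr
  have hnσ : partialSum p σ = n := hsum
  have hn1 : partialSum p (r + 1) ≤ n := hnσ ▸ partialSum_mono p hr
  have hps := partialSum_succ p r
  have hrle : r ≤ partialSum p r := by
    have : ∑ t ∈ Finset.Icc 1 r, 1 ≤ partialSum p r :=
      Finset.sum_le_sum fun t ht => by
        rw [Finset.mem_Icc] at ht; exact hp1' t ht.1 (by omega)
    simpa using this
  have hanti' : ∀ i j, 1 ≤ i → i ≤ j → j ≤ r → p j ≤ p i :=
    fun i j h1 h2 h3 => hanti i j h1 h2 (by omega)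
  have hGr₀ : Gram B g p r v₀ := hG.gram halt hg hiso hWmono (by omega)
    (fun t h1 h2 => hp1' t h1 (by omega))
  obtain ⟨x, hxm, hxn, hxo⟩ := exists_next B g W n hg hWmono hWdim p r v₀ hG hGr₀ hanti' (by omega)
  obtain ⟨v, hvx, hv⟩ : ∃ v : ℕ → V, v (r + 1) = x ∧ ∀ t, t ≤ r → v t = v₀ t :=
    ⟨Function.update v₀ (r + 1) x, by simp, fun t ht => Function.update_of_ne (by omega) _ _⟩
  subst hvx
  have hG : Good B g W p r v := by
    refine ⟨?_, ?_, ?_, ?_⟩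
    · intro t h1 h2; rw [hv t h2]; exact hG.mem t h1 h2
    · intro t h1 h2; rw [hv t h2]; exact hG.nmem t h1 h2
    · intro s t h1 h2 h3; rw [hv t h3, hv s (by omega)]; exact hG.orth s t h1 h2 h3
    · intro t h1 h2; rw [hv t h2]; exact hG.diag t h1 h2
  have hGr : Gram B g p r v := hG.gram halt hg hiso hWmono (by omega)
    (fun t h1 h2 => hp1' t h1 (by omega))
  have hxo : ∀ s, 1 ≤ s → s ≤ r → ∀ i : ℤ, 1 ≤ i → i ≤ p s →
      B (v s) ((g ^ i) (v (r + 1))) = 0 := by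
    intro s h1 h2; rw [hv s h2]; exact hxo s h1 h2
  clear hGr₀ hv
  obtain ⟨hrel1, hrel2, hrel3⟩ := hrel (r + 1) (Finset.mem_Icc.2 ⟨by omega, hr⟩)
  have hr1 : r + 1 - 1 = r := rfl
  rw [hr1] at hrel1 hrel2 hrel3
  simp only [Finset.mem_Icc] at hrel1
  have hsucc : ∀ (j : ℕ) (y : V), g ((g ^ (j : ℤ)) y) = (g ^ ((j + 1 : ℕ) : ℤ)) y := by
    intro j y
    push_cast
    rw [add_comm, zpow_one_add]; rfl
  -- v s lies in the isotropic part
  have hvs : ∀ s, 1 ≤ s → s ≤ r → v s ∈ W (partialSum p r) := by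
    intro s h1 h2
    have h3 := partialSum_pred p h1
    have h4 := partialSum_mono p h2
    have h5 := hp1' s h1 (by omega)
    exact hWmono _ _ (by omega) (by omega) (hG.mem s h1 h2 0 (by omega))
  -- membership via Lemma F
  have hF : ∀ i, 1 ≤ i → i ≤ p (r + 1) →
      (g ^ ((i - 1 : ℕ) : ℤ)) (v (r + 1)) ∈ W (partialSum p r + i) → ∀ Y : Submodule k V,
      (∀ y ∈ Y, ∀ z ∈ W (partialSum p r), B z y = 0) →
      Module.finrank k ↥(Submodule.map g.toLinearMap (W (partialSum p r + i)) ⊓ Y)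
        = partialSum p r + i - (r + 1) + 1 → (g ^ (i : ℤ)) (v (r + 1)) ∈ Y := by
    intro i hi1 hi2 hmem Y hY hdim
    refine hGr.memOf hanti' (fun t h1 h2 => hp1' t h1 (by omega))
      (Submodule.map g.toLinearMap (W (partialSum p r + i))) Y _ ?_ ?_ ?_ ?_ ?_
    · intro t h1 h2
      have h3 := hp1' t h1 (by omega)
      have h4 := partialSum_pred p h1
      have h5 := partialSum_mono p h2
      refine ⟨(g ^ ((p t - 1 : ℕ) : ℤ)) (v t),
        hWmono _ _ (by omega) (by omega) (hG.mem t h1 h2 (p t - 1) (by omega)), ?_⟩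
      have := hsucc (p t - 1) (v t)
      rw [Nat.sub_add_cancel h3] at this
      exact this
    · refine ⟨_, hmem, ?_⟩
      have := hsucc (i - 1) (v (r + 1))
      rw [Nat.sub_add_cancel hi1] at this
      exact this
    · intro t h1 h2
      have := hanti t (r + 1) h1 (by omega) hr
      exact hxo t h1 h2 i (by omega) (by omega)
    · intro t h1 h2 y hy
      exact hY y hy _ (hvs t h1 h2)
    · rw [hdim, LinearEquiv.finrank_map_eq, hWdim _ (by omega)]
      omega
  have hflag : ∀ i, i < p (r + 1) → ∀ j, j ≤ i →
      (g ^ (j : ℤ)) (v (r + 1)) ∈ W (partialSum p r + j + 1) ∧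
      (g ^ (j : ℤ)) (v (r + 1)) ∉ W (partialSum p r + j) := by
    intro i
    induction i with
    | zero =>
      intro _ j hj
      obtain rfl : j = 0 := by omega
      exact ⟨hxm, hxn⟩
    | succ i ih =>
      intro hi j hj
      have ih' := ih (by omega)
      rcases Nat.lt_or_ge j (i + 1) with hj' | hj'
      · exact ih' j (by omega)
      obtain rfl : j = i + 1 := by omega
      obtain ⟨ha, hb⟩ := hrel1 (i + 1) ⟨by omega, by omega⟩
      refine ⟨?_, ?_⟩
      · refine hF (i + 1) (by omega) (by omega) (ih' i le_rfl).1 _ ?_ hb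
        intro y hy z hz
        exact hiso _ (hWmono _ n (by omega) (by omega) hz) _ (hWmono _ n (by omega) (by omega) hy)
      · intro hcon
        have := flagCount g W n hWmono p r (i + 1) v (fun t h1 h2 => hp1' t h1 (by omega))
          (by omega) hn1 ?_ ?_ (W (partialSum p r + (i + 1))) ?_ ?_
        · omega
        · intro t h1 h2 j h3 h4
          by_cases ht : t = r + 1
          · have := h4 ht
            subst ht
            exact (ih' j (by omega)).1
          · exact hG.mem t h1 (by omega) j h3
        · intro t h1 h2 j h3 h4
          by_cases ht : t = r + 1
          · have := h4 ht
            subst ht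
            exact (ih' j (by omega)).2
          · exact hG.nmem t h1 (by omega) j h3
        · intro t h1 h2 j h3
          have h4 := partialSum_pred p h1
          have h5 := partialSum_mono p h2
          exact hWmono _ _ (by omega) (by omega) (hG.mem t h1 h2 (j + 1) h3)
        · intro j hj
          rcases Nat.lt_or_ge j i with hj' | hj'
          · exact hWmono _ _ (by omega) (by omega) (ih' (j + 1) (by omega)).1
          · obtain rfl : j = i := by omega
            exact hcon
  have hfl := hflag (p (r + 1) - 1) (by omega)
  have hmemAll : ∀ t, 1 ≤ t → t ≤ r + 1 → ∀ j : ℕ, j < p t →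
      (g ^ (j : ℤ)) (v t) ∈ W (partialSum p (t - 1) + j + 1) := by
    intro t h1 h2 j h3
    by_cases ht : t = r + 1
    · subst ht
      exact (hfl j (by omega)).1
    · exact hG.mem t h1 (by omega) j h3
  have hnmemAll : ∀ t, 1 ≤ t → t ≤ r + 1 → ∀ j : ℕ, j < p t →
      (g ^ (j : ℤ)) (v t) ∉ W (partialSum p (t - 1) + j) := by
    intro t h1 h2 j h3
    by_cases ht : t = r + 1
    · subst ht
      exact (hfl j (by omega)).2
    · exact hG.nmem t h1 (by omega) j h3
  refine ⟨v, hmemAll, hnmemAll, ?_, ?_⟩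
  · intro s t h1 h2 h3 i hi1 hi2
    by_cases ht : t = r + 1
    · subst ht
      exact hxo s h1 (by omega) i hi1 hi2
    · exact hG.orth s t h1 h2 (by omega) i hi1 hi2
  · intro t h1 h2
    by_cases ht : t = r + 1
    swap
    · exact hG.diag t h1 (by omega)
    subst ht
    intro hcon
    rw [hps] at hrel2 hrel3
    have hlast : (g ^ (p (r + 1) : ℤ)) (v (r + 1)) ∈ W (2 * n - partialSum p r) := by
      refine hF (p (r + 1)) hpr le_rfl ?_ _ ?_ hrel3
      · have := (hfl (p (r + 1) - 1) le_rfl).1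
        rwa [show partialSum p r + (p (r + 1) - 1) + 1 = partialSum p r + p (r + 1) by omega]
          at this
      · intro y hy z hz
        rw [← hWperp _ (by omega)] at hy
        rw [skew B halt, hy z hz, neg_zero]
    have hspan : W (partialSum p r) ⊔ Submodule.span k {v (r + 1)} = W (partialSum p r + 1) := by
      apply Submodule.eq_of_le_of_finrank_le
      · refine sup_le (hWmono _ _ (by omega) (by omega)) ?_
        rw [Submodule.span_singleton_le_iff_mem]; exact hxm
      · have hlt : W (partialSum p r) < W (partialSum p r) ⊔ Submodule.span k {v (r + 1)} := by
          refine lt_of_le_of_ne le_sup_left fun h => hxn ?_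
          rw [h]
          exact Submodule.mem_sup_right (Submodule.mem_span_singleton_self _)
        have := Submodule.finrank_lt_finrank_of_lt hlt
        rw [hWdim _ (by omega)] at this
        rw [hWdim _ (by omega)]
        omega
    have hperp : (g ^ (p (r + 1) : ℤ)) (v (r + 1)) ∈ W (2 * n - partialSum p r - 1) := by
      rw [show 2 * n - partialSum p r - 1 = 2 * n - (partialSum p r + 1) by omega,
        ← hWperp _ (by omega)]
      rw [← hWperp _ (by omega)] at hlast
      have : W (partialSum p r + 1) ≤ LinearMap.ker (B ((g ^ (p (r + 1) : ℤ)) (v (r + 1)))) := by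
        rw [← hspan]
        refine sup_le (fun z hz => hlast z hz) ?_
        rw [Submodule.span_singleton_le_iff_mem, LinearMap.mem_ker, skew B halt, hcon, neg_zero]
      exact fun z hz => this hz
    have := flagCount g W n hWmono p r (p (r + 1)) v (fun t h1 h2 => hp1' t h1 (by omega))
      le_rfl hn1 (fun t h1 h2 j h3 _ => hmemAll t h1 h2 j h3)
      (fun t h1 h2 j h3 _ => hnmemAll t h1 h2 j h3) (W (2 * n - partialSum p r - 1)) ?_ ?_
    · omega
    · intro t h1 h2 j h3
      have h4 := partialSum_pred p h1
      have h5 := partialSum_mono p h2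
      exact hWmono _ _ (by omega) (by omega) (hG.mem t h1 h2 (j + 1) h3)
    · intro j hj
      rcases Nat.lt_or_ge (j + 1) (p (r + 1)) with hj' | hj'
      · exact hWmono _ _ (by omega) (by omega) (hfl (j + 1) (by omega)).1
      · obtain h : j + 1 = p (r + 1) := by omega
        rw [h]
        exact hperp

/-- 3.5(a), lower bound: if `g` is a unipotent isometry of a `2n`-dimensional
symplectic space `(V, B)` such that `(g, V_*)` is in relative position `w_{p_*}` with respect to
a complete isotropic flag `V_*`, then with `N = g − 1`, for every `K ≥ 0` one has
`dim N^K(V) ≥ Σ_{r=1}^{σ} max(2p_r − K, 0)` (in `ℕ`, `2 * p r - K` is truncated subtraction). -/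
theorem stmt_13 [FiniteDimensional k V] (n σ : ℕ) (p : ℕ → ℕ)
    (hp : IsPartitionOf n σ p) (hn : 2 ≤ n)
    (B : V →ₗ[k] V →ₗ[k] k)
    (halt : ∀ x : V, B x x = 0)
    (hnd : ∀ x : V, (∀ y : V, B x y = 0) → x = 0)
    (hdim : Module.finrank k V = 2 * n)
    (W : ℕ → Submodule k V)
    (hW0 : W 0 = ⊥) (hWtop : W (2 * n) = ⊤)
    (hWmono : ∀ i j, i ≤ j → j ≤ 2 * n → W i ≤ W j)
    (hWdim : ∀ i ≤ 2 * n, Module.finrank k ↥(W i) = i)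
    (hWperp : ∀ i ≤ n, perpSub B (W i) = W (2 * n - i))
    (g : V ≃ₗ[k] V)
    (hg : ∀ x y : V, B (g x) (g y) = B x y)
    (hgu : IsNilpotent (g.toLinearMap - LinearMap.id : Module.End k V))
    (hrel : RelPos g W σ p (2 * n)) :
    ∀ K : ℕ,
      ∑ r ∈ Finset.Icc 1 σ, (2 * p r - K) ≤
        Module.finrank k
          (LinearMap.range ((g.toLinearMap - LinearMap.id : Module.End k V) ^ K)) := by
  have hiso : ∀ x ∈ W n, ∀ y ∈ W n, B x y = 0 := by
    intro x hx y hy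
    have h := hWperp n le_rfl
    rw [show 2 * n - n = n by omega] at h
    rw [← h] at hx
    exact hx y hy
  have hall : ∀ r, r ≤ σ → ∃ v, Good B g W p r v := by
    intro r
    induction r with
    | zero =>
      intro _
      exact ⟨fun _ => 0, fun t h1 h2 => absurd h2 (by omega), fun t h1 h2 => absurd h2 (by omega),
        fun s t h1 h2 h3 => absurd h3 (by omega), fun t h1 h2 => absurd h2 (by omega)⟩
    | succ r ih =>
      intro hr
      obtain ⟨v, hv⟩ := ih (by omega)
      exact step n σ p hp B halt W hWmono hWdim hWperp g hg hiso hrel r hr v hv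
  obtain ⟨v, hv⟩ := hall σ le_rfl
  obtain ⟨-, hp1, hanti, hsum⟩ := hp
  have hGr := hv.gram halt hg hiso hWmono (le_of_eq hsum)
    (fun t h1 h2 => hp1 t (Finset.mem_Icc.2 ⟨h1, h2⟩))
  exact fun K => hGr.final hg hanti K

end
end

section
/- Let k be a field and V a k-vector space of dimension 2n (n ≥ 2) with a nondegenerate alternating bilinear form (,). Let V_* = (0 = V_0 ⊂ V_1 ⊂ … ⊂ V_{2n} = V) be a complete isotropic flag, let p_* = (p_1 ≥ … ≥ p_σ) ∈ 𝒫_n, and let g be an isometry of V such that (g, V_*) satisfies the w_{p_*}-relative position conditions. Then the set of all x ∈ GL(V) such that (xu, xv) = (u, v) for all u, v ∈ V, xg = gx, and xV_i = V_i for all i ∈ [0, 2n], is finite. -/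
section

variable {k V : Type*} [Field k] [AddCommGroup V] [Module k V]

namespace S15

section

variable {k V : Type*} [Field k] [AddCommGroup V] [Module k V]

/-- The hypotheses actually used, with blocks indexed from `0`. -/
structure Ctx (B : V →ₗ[k] V →ₗ[k] k) (f : Module.End k V) (W : ℕ → Submodule k V)
    (n σ : ℕ) (q S : ℕ → ℕ) : Prop where
  S0 : S 0 = 0
  Ss : ∀ r, S (r + 1) = S r + q r
  Sn : S σ = n
  qpos : ∀ r < σ, 1 ≤ q r
  qanti : ∀ t r, t ≤ r → r < σ → q r ≤ q t
  W0 : W 0 = ⊥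
  Wmono : ∀ i j, i ≤ j → j ≤ 2 * n → W i ≤ W j
  Wdim : ∀ i ≤ 2 * n, Module.finrank k (W i) = i
  perp : ∀ i ≤ n, ∀ y, y ∈ W (2 * n - i) ↔ ∀ z ∈ W i, B y z = 0
  ne1 : ∀ r < σ, ∀ i, 1 ≤ i → i < q r →
    ∃ u ∈ W (S r + i), f u ∈ W (S r + i + 1) ∧ f u ∉ W (S r + i)
  ne2 : ∀ r < σ, ∃ u ∈ W (S r + q r), f u ∈ W (2 * n - S r) ∧ f u ∉ W (2 * n - (S r + 1))

/-- The vectors `v_0, …, v_{r-1}` are adapted to the flag. -/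
structure Good (B : V →ₗ[k] V →ₗ[k] k) (f : Module.End k V) (W : ℕ → Submodule k V)
    (q S : ℕ → ℕ) (v : ℕ → V) (r : ℕ) : Prop where
  A : ∀ t < r, ∀ i < q t, (f ^ i) (v t) ∈ W (S t + i + 1) ∧ (f ^ i) (v t) ∉ W (S t + i)
  Z : ∀ s < r, ∀ t < s, ∀ i, 1 ≤ i → i ≤ q t → B ((f ^ i) (v s)) (v t) = 0
  C : ∀ t < r, B ((f ^ (q t)) (v t)) (v t) ≠ 0

variable {B : V →ₗ[k] V →ₗ[k] k} {f : Module.End k V} {W : ℕ → Submodule k V}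
    {n σ : ℕ} {q S : ℕ → ℕ}

theorem Good.mono {v : ℕ → V} {r s : ℕ} (h : Good B f W q S v r) (hs : s ≤ r) :
    Good B f W q S v s :=
  ⟨fun t ht => h.A t (by omega), fun a ha => h.Z a (by omega), fun t ht => h.C t (by omega)⟩

theorem Ctx.Smono (c : Ctx B f W n σ q S) {a b : ℕ} (h : a ≤ b) : S a ≤ S b := by
  induction h with
  | refl => exact le_rfl
  | step _ ih => rw [Nat.succ_eq_add_one, c.Ss]; omega

theorem Ctx.Sle (c : Ctx B f W n σ q S) {a : ℕ} (h : a ≤ σ) : S a ≤ n := by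
  have := c.Smono h
  rwa [c.Sn] at this

theorem Ctx.Sle' (c : Ctx B f W n σ q S) {a : ℕ} (h : a < σ) : S a + q a ≤ n := by
  have := c.Sle (a := a + 1) h
  rwa [c.Ss] at this

theorem Ctx.iso (c : Ctx B f W n σ q S) {a b : ℕ} (ha : a ≤ n) (hb : b ≤ n) {y z : V}
    (hy : y ∈ W a) (hz : z ∈ W b) : B y z = 0 := by
  have hy' : y ∈ W (2 * n - n) := c.Wmono a _ (by omega) (by omega) hy
  exact (c.perp n le_rfl y).1 hy' z (c.Wmono b n hb (by omega) hz)

theorem Ctx.step [FiniteDimensional k V] (c : Ctx B f W n σ q S) {a : ℕ} (ha : a + 1 ≤ 2 * n)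
    {z : V} (hz : z ∈ W (a + 1)) (hz' : z ∉ W a) {y : V} (hy : y ∈ W (a + 1)) :
    ∃ b : k, y - b • z ∈ W a := by
  have h1 : W a ≤ W a ⊔ Submodule.span k {z} := le_sup_left
  have h2 : W a ⊔ Submodule.span k {z} ≤ W (a + 1) :=
    sup_le (c.Wmono a (a + 1) (by omega) ha) (by simpa using hz)
  have h3 : W a < W a ⊔ Submodule.span k {z} := by
    refine lt_of_le_of_ne h1 fun h => hz' ?_
    rw [h]
    exact Submodule.mem_sup_right (Submodule.mem_span_singleton_self z)
  have h4 := Submodule.finrank_lt_finrank_of_lt h3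
  have h5 : W a ⊔ Submodule.span k {z} = W (a + 1) := by
    apply Submodule.eq_of_le_of_finrank_le h2
    rw [c.Wdim _ ha]
    rw [c.Wdim _ (by omega)] at h4
    omega
  rw [← h5] at hy
  obtain ⟨w, hw, u, hu, rfl⟩ := Submodule.mem_sup.1 hy
  obtain ⟨b, rfl⟩ := Submodule.mem_span_singleton.1 hu
  exact ⟨b, by simpa using hw⟩

/-- span of the `f^{q_t} v_t`, `t < r`. -/
def U (f : Module.End k V) (q : ℕ → ℕ) (v : ℕ → V) (r : ℕ) : Submodule k V :=
  Submodule.span k (Set.range fun t : Fin r => (f ^ (q t)) (v t))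

theorem Good.memW {v : ℕ → V} {r : ℕ} (h : Good B f W q S v r) (c : Ctx B f W n σ q S)
    (hr : r ≤ σ) {t : ℕ} (ht : t < r) {i : ℕ} (hi : i < q t) : (f ^ i) (v t) ∈ W (S r) := by
  have h1 := c.Smono (a := t + 1) (b := r) ht
  rw [c.Ss] at h1
  have := c.Sle hr
  exact c.Wmono _ _ (by omega) (by omega) (h.A t ht i hi).1

theorem Good.memW0 {v : ℕ → V} {r : ℕ} (h : Good B f W q S v r) (c : Ctx B f W n σ q S)
    (hr : r ≤ σ) {t : ℕ} (ht : t < r) : v t ∈ W (S r) := by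
  simpa using h.memW c hr ht (i := 0) (c.qpos t (by omega))

theorem E1 [FiniteDimensional k V] (c : Ctx B f W n σ q S) {v : ℕ → V} {r : ℕ} (hr : r < σ)
    (h0 : ∀ y ∈ W (S r), f y ∈ W (S r) ⊔ U f q v r) (z : V) (i : ℕ) (hi : i ≤ q r)
    (hz : ∀ l < i, (f ^ l) z ∈ W (S r + l + 1) ∧ (f ^ l) z ∉ W (S r + l)) :
    ∀ y ∈ W (S r + i), f y ∈ W (S r + i) ⊔ U f q v r ⊔ Submodule.span k {(f ^ i) z} := by
  induction i with
  | zero => exact fun y hy => Submodule.mem_sup_left (h0 y hy)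
  | succ i ih =>
    intro y hy
    have hn := c.Sle' hr
    obtain ⟨h1, h2⟩ := hz i (by omega)
    obtain ⟨b, hb⟩ := c.step (a := S r + i) (by omega) h1 h2 hy
    have h3 := ih (by omega) (fun l hl => hz l (by omega)) _ hb
    have h4 : W (S r + i) ⊔ U f q v r ⊔ Submodule.span k {(f ^ i) z} ≤
        W (S r + (i + 1)) ⊔ U f q v r := by
      refine sup_le (sup_le_sup_right (c.Wmono _ _ (by omega) (by omega)) _) ?_
      rw [Submodule.span_singleton_le_iff_mem]
      exact Submodule.mem_sup_left h1
    have h5 : f y = f (y - b • (f ^ i) z) + b • (f ^ (i + 1)) z := by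
      rw [pow_succ', Module.End.mul_apply]
      simp
    rw [h5]
    exact add_mem (Submodule.mem_sup_left (h4 h3))
      (Submodule.mem_sup_right (Submodule.smul_mem _ _ (Submodule.mem_span_singleton_self _)))

theorem E0 [FiniteDimensional k V] (c : Ctx B f W n σ q S) {v : ℕ → V} (r : ℕ) (hr : r ≤ σ)
    (h : Good B f W q S v r) : ∀ y ∈ W (S r), f y ∈ W (S r) ⊔ U f q v r := by
  induction r with
  | zero =>
    intro y hy
    rw [c.S0, c.W0, Submodule.mem_bot] at hy
    simp [hy]
  | succ r ih =>
    intro y hy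
    rw [c.Ss] at hy ⊢
    have := E1 c (v := v) (r := r) (by omega) (ih (by omega) (h.mono (by omega))) (v r) (q r) le_rfl
      (h.A r (by omega)) y hy
    refine (sup_le (sup_le_sup_left ?_ _) ?_ : _ ≤ W (S r + q r) ⊔ U f q v (r + 1)) this
    · apply Submodule.span_mono
      rintro _ ⟨t, rfl⟩
      exact ⟨⟨t, by omega⟩, rfl⟩
    · rw [Submodule.span_singleton_le_iff_mem]
      exact Submodule.mem_sup_right (Submodule.subset_span ⟨⟨r, by omega⟩, rfl⟩)

theorem T (c : Ctx B f W n σ q S) {v : ℕ → V} {r : ℕ} (hr : r ≤ σ)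
    (h : Good B f W q S v r) {u : V} (hu : u ∈ U f q v r) (hp : ∀ s < r, B u (v s) = 0) :
    u = 0 := by
  obtain ⟨α, rfl⟩ := (Submodule.mem_span_range_iff_exists_fun k).1 hu
  have key : ∀ s, ∀ hs : s < r, α ⟨s, hs⟩ = 0 := by
    intro s
    induction s using Nat.strong_induction_on with
    | _ s ih =>
      intro hs
      have h1 := hp s hs
      rw [map_sum, LinearMap.sum_apply, Finset.sum_eq_single ⟨s, hs⟩] at h1
      · simpa [h.C s hs] using h1
      · rintro ⟨t, ht⟩ - hne
        rcases lt_trichotomy t s with h2 | h2 | h2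
        · simp [ih t h2 ht]
        · exact absurd (Fin.ext h2) hne
        · simp [h.Z t ht s h2 (q t) (c.qpos t (by omega)) (c.qanti s t h2.le (by omega))]
      · simp
  exact Finset.sum_eq_zero fun i _ => by rw [key i.1 i.2, zero_smul]

theorem Q [FiniteDimensional k V] (c : Ctx B f W n σ q S) {v : ℕ → V} {r : ℕ} (hr : r < σ)
    (h : Good B f W q S v r) (z : V) (i : ℕ) (hi1 : 1 ≤ i) (hi : i ≤ q r)
    (hz : ∀ l < i, (f ^ l) z ∈ W (S r + l + 1) ∧ (f ^ l) z ∉ W (S r + l))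
    (hzZ : ∀ t < r, ∀ i, 1 ≤ i → i ≤ q t → B ((f ^ i) z) (v t) = 0)
    (y : V) (hy : y ∈ W (S r + i)) (hp : ∀ s < r, B (f y) (v s) = 0) :
    ∃ b : k, f y - b • (f ^ i) z ∈ W (S r + i) := by
  have h1 := E1 c hr (E0 c r hr.le h) z i hi hz y hy
  obtain ⟨a, ha, d, hd, he⟩ := Submodule.mem_sup.1 h1
  obtain ⟨w, hw, u, hu, rfl⟩ := Submodule.mem_sup.1 ha
  obtain ⟨b, rfl⟩ := Submodule.mem_span_singleton.1 hd
  have hn := c.Sle' hr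
  have hu0 : u = 0 := by
    refine T c hr.le h hu fun s hs => ?_
    have h2 := hp s hs
    rw [← he] at h2
    have h3 : B w (v s) = 0 := c.iso (by omega) (c.Sle hr.le) hw (h.memW0 c hr.le hs)
    have h4 := hzZ s hs i hi1 (hi.trans (c.qanti s r hs.le hr))
    simpa [h3, h4] using h2
  refine ⟨b, ?_⟩
  rw [← he, hu0]
  simpa using hw

theorem spanW [FiniteDimensional k V] (c : Ctx B f W n σ q S) {v : ℕ → V} (r : ℕ) (hr : r ≤ σ)
    (h : Good B f W q S v r) :
    W (S r) ≤ Submodule.span k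
      (Set.range fun i : (Σ t : Fin r, Fin (q t)) => (f ^ (i.2 : ℕ)) (v i.1)) := by
  induction r with
  | zero => rw [c.S0, c.W0]; exact bot_le
  | succ r ih =>
    have hn := c.Sle' (a := r) (by omega)
    have key : ∀ i ≤ q r, W (S r + i) ≤ Submodule.span k
      (Set.range fun i : (Σ t : Fin (r + 1), Fin (q t)) => (f ^ (i.2 : ℕ)) (v i.1)) := by
      intro i
      induction i with
      | zero =>
        intro _
        refine (ih (by omega) (h.mono (by omega))).trans (Submodule.span_mono ?_)
        rintro _ ⟨⟨t, j⟩, rfl⟩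
        exact ⟨⟨⟨t, by omega⟩, j⟩, rfl⟩
      | succ i ih2 =>
        intro hi y hy
        obtain ⟨h1, h2⟩ := h.A r (by omega) i (by omega)
        obtain ⟨b, hb⟩ := c.step (a := S r + i) (by omega) h1 h2 hy
        have h3 := ih2 (by omega) hb
        have : y = (y - b • (f ^ i) (v r)) + b • (f ^ i) (v r) := by simp
        rw [this]
        refine add_mem h3 (Submodule.smul_mem _ _ (Submodule.subset_span ?_))
        exact ⟨⟨⟨r, by omega⟩, ⟨i, by simpa using hi⟩⟩, rfl⟩
    rw [c.Ss]
    exact key _ le_rfl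

theorem inj [FiniteDimensional k V] (c : Ctx B f W n σ q S) {v : ℕ → V} {r : ℕ} (hr : r ≤ σ)
    (h : Good B f W q S v r) {y : V} (hy : y ∈ W (S r))
    (hp : ∀ t < r, ∀ i, 1 ≤ i → i ≤ q t → B ((f ^ i) y) (v t) = 0) : y = 0 := by
  obtain ⟨α, rfl⟩ := (Submodule.mem_span_range_iff_exists_fun k).1 (spanW c r hr h hy)
  have hiso : ∀ t < r, ∀ s < r, ∀ e < q t, B ((f ^ e) (v t)) (v s) = 0 := fun t ht s hs e he =>
    c.iso (c.Sle hr) (c.Sle hr) (h.memW c hr ht he) (h.memW0 c hr hs)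
  have key : ∀ d, ∀ s, ∀ hs : s < r, ∀ j, ∀ hj : j < q s, j + d = q s →
      α ⟨⟨s, hs⟩, ⟨j, hj⟩⟩ = 0 := by
    intro d
    induction d using Nat.strong_induction_on with
    | _ d ihd =>
      intro s
      induction s using Nat.strong_induction_on with
      | _ s ih =>
        intro hs j hj hjd
        have h1 := hp s hs d (by omega) (by omega)
        rw [map_sum, map_sum, LinearMap.sum_apply,
          Finset.sum_eq_single ⟨⟨s, hs⟩, ⟨j, hj⟩⟩] at h1
        · have h2 : (f ^ d) ((f ^ j) (v s)) = (f ^ (q s)) (v s) := by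
            rw [← Module.End.mul_apply, ← pow_add, add_comm, hjd]
          simpa [h2, h.C s hs] using h1
        · rintro ⟨⟨t, ht⟩, ⟨l, hl⟩⟩ - hne
          simp only at hl
          have h2 : (f ^ d) ((f ^ l) (v t)) = (f ^ (d + l)) (v t) := by
            rw [← Module.End.mul_apply, ← pow_add]
          simp only [map_smul, LinearMap.smul_apply, h2, smul_eq_mul]
          rcases lt_trichotomy (d + l) (q t) with h3 | h3 | h3
          · rw [hiso t ht s hs _ h3, mul_zero]
          · rcases lt_trichotomy t s with h4 | h4 | h4
            · rw [ih t h4 ht l hl (by omega), zero_mul]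
            · subst h4
              have : l = j := by omega
              subst this
              exact absurd rfl hne
            · rw [h.Z t ht s h4 _ (by omega)
                (h3.le.trans (c.qanti s t h4.le (by omega))), mul_zero]
          · rw [ihd (q t - l) (by omega) t ht l hl (by omega), zero_mul]
        · simp
  refine Finset.sum_eq_zero ?_
  rintro ⟨⟨t, ht⟩, ⟨l, hl⟩⟩ -
  simp only at hl
  rw [key (q t - l) t ht l hl (by omega), zero_smul]

theorem Ctx.Ssum (c : Ctx B f W n σ q S) (r : ℕ) : S r = ∑ t : Fin r, q t := by
  induction r with
  | zero => simp [c.S0]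
  | succ r ih => rw [c.Ss, ih, Fin.sum_univ_castSucc]; simp

theorem exZ [FiniteDimensional k V] (c : Ctx B f W n σ q S) {v : ℕ → V} {r : ℕ} (hr : r < σ)
    (h : Good B f W q S v r) : ∃ z ∈ W (S r + 1), z ∉ W (S r) ∧
      ∀ t < r, ∀ i, 1 ≤ i → i ≤ q t → B ((f ^ i) z) (v t) = 0 := by
  have hn := c.Sle' hr
  have hq := c.qpos r hr
  let Φ : W (S r + 1) →ₗ[k] ((Σ t : Fin r, Fin (q t)) → k) :=
    LinearMap.pi fun i => (B.flip (v i.1)) ∘ₗ (f ^ ((i.2 : ℕ) + 1)) ∘ₗ (W (S r + 1)).subtype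
  have hlt : Module.finrank k ((Σ t : Fin r, Fin (q t)) → k) < Module.finrank k (W (S r + 1)) := by
    rw [c.Wdim _ (by omega), Module.finrank_fintype_fun_eq_card, Fintype.card_sigma]
    simp [c.Ssum r]
  have hker := LinearMap.ker_ne_bot_of_finrank_lt (f := Φ) hlt
  obtain ⟨⟨z, hz⟩, hzk, hz0⟩ := Submodule.exists_mem_ne_zero_of_ne_bot hker
  have hZ : ∀ t < r, ∀ i, 1 ≤ i → i ≤ q t → B ((f ^ i) z) (v t) = 0 := by
    intro t ht i hi hi'
    have := congrFun (LinearMap.mem_ker.1 hzk) ⟨⟨t, ht⟩, ⟨i - 1, by simp; omega⟩⟩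
    simpa [Φ, Nat.sub_add_cancel hi] using this
  refine ⟨z, hz, fun hzW => hz0 ?_, hZ⟩
  exact Subtype.ext (inj c hr.le h hzW hZ)

theorem ext1 [FiniteDimensional k V] (c : Ctx B f W n σ q S) {v : ℕ → V} {r : ℕ} (hr : r < σ)
    (h : Good B f W q S v r) : ∃ z,
      (∀ i < q r, (f ^ i) z ∈ W (S r + i + 1) ∧ (f ^ i) z ∉ W (S r + i)) ∧
      (∀ t < r, ∀ i, 1 ≤ i → i ≤ q t → B ((f ^ i) z) (v t) = 0) ∧
      B ((f ^ (q r)) z) z ≠ 0 := by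
  obtain ⟨z, hz1, hz2, hZ⟩ := exZ c hr h
  have hn := c.Sle' hr
  have hq := c.qpos r hr
  have hA : ∀ i < q r, (f ^ i) z ∈ W (S r + i + 1) ∧ (f ^ i) z ∉ W (S r + i) := by
    intro i
    induction i using Nat.strong_induction_on with
    | _ i ih =>
      intro hi
      rcases Nat.eq_zero_or_pos i with rfl | hi0
      · exact ⟨by simpa using hz1, by simpa using hz2⟩
      obtain ⟨u, hu, hu1, hu2⟩ := c.ne1 r hr i hi0 hi
      obtain ⟨b, hb⟩ := Q c hr h z i hi0 hi.le (fun l hl => ih l hl (by omega)) hZ u hu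
        (fun s hs => c.iso (by omega) (c.Sle hr.le) hu1 (h.memW0 c hr.le hs))
      have hb0 : b ≠ 0 := by
        rintro rfl
        exact hu2 (by simpa using hb)
      constructor
      · have h3 := sub_mem hu1 (c.Wmono _ (S r + i + 1) (by omega) (by omega) hb)
        rw [sub_sub_cancel] at h3
        exact (Submodule.smul_mem_iff _ hb0).1 h3
      · intro h3
        apply hu2
        have := add_mem hb (Submodule.smul_mem _ b h3)
        simpa using this
  refine ⟨z, hA, hZ, fun h0 => ?_⟩
  obtain ⟨u, hu, hu1, hu2⟩ := c.ne2 r hr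
  have hu1' := (c.perp _ (by omega) _).1 hu1
  obtain ⟨b, hb⟩ := Q c hr h z (q r) hq le_rfl hA hZ u hu
    (fun s hs => hu1' _ (h.memW0 c hr.le hs))
  apply hu2
  rw [c.perp _ (by omega)]
  intro w hw
  obtain ⟨a, ha⟩ := c.step (by omega) hz1 hz2 hw
  have h1 := hu1' _ ha
  have h2 : B (f u - b • (f ^ (q r)) z) z = 0 := c.iso hn (by omega) hb hz1
  have h3 : B (f u) z = 0 := by simpa [h0] using h2
  simpa [h3] using h1

theorem exGood [FiniteDimensional k V] (c : Ctx B f W n σ q S) (r : ℕ) (hr : r ≤ σ) :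
    ∃ v, Good B f W q S v r := by
  induction r with
  | zero => exact ⟨fun _ => 0, ⟨by simp, by simp, by simp⟩⟩
  | succ r ih =>
    obtain ⟨v, h⟩ := ih (by omega)
    obtain ⟨z, hA, hZ, hC⟩ := ext1 c (by omega) h
    have hne : ∀ t < r, Function.update v r z t = v t := fun t ht =>
      Function.update_of_ne (by omega) _ _
    refine ⟨Function.update v r z, ⟨?_, ?_, ?_⟩⟩
    · intro t ht
      rcases Nat.lt_succ_iff_lt_or_eq.1 ht with h1 | rfl
      · rw [hne t h1]; exact h.A t h1
      · simpa using hA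
    · intro s hs t ht
      rw [hne t (by omega)]
      rcases Nat.lt_succ_iff_lt_or_eq.1 hs with h1 | rfl
      · rw [hne s h1]; exact h.Z s h1 t ht
      · simpa using hZ t ht
    · intro t ht
      rcases Nat.lt_succ_iff_lt_or_eq.1 ht with h1 | rfl
      · rw [hne t h1]; exact h.C t h1
      · simpa using hC

theorem powcomm {f x : Module.End k V} (hx : ∀ y, x (f y) = f (x y)) (j : ℕ) (y : V) :
    x ((f ^ j) y) = (f ^ j) (x y) := by
  induction j with
  | zero => simp
  | succ j ih => rw [pow_succ', Module.End.mul_apply, Module.End.mul_apply, hx, ih]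

theorem sgn [FiniteDimensional k V] (c : Ctx B f W n σ q S) {v : ℕ → V}
    (h : Good B f W q S v σ) (x : Module.End k V) (hB : ∀ u w, B (x u) (x w) = B u w)
    (hx : ∀ y, x (f y) = f (x y)) (hW : ∀ i ≤ 2 * n, ∀ y ∈ W i, x y ∈ W i) (r : ℕ) (hr : r < σ) :
    x (v r) = v r ∨ x (v r) = - v r := by
  induction r using Nat.strong_induction_on with
  | _ r ih =>
    have hn := c.Sle' hr
    have hq := c.qpos r hr
    obtain ⟨h1, h2⟩ := h.A r hr 0 hq
    simp only [pow_zero, Module.End.one_apply, add_zero] at h1 h2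
    obtain ⟨b, hb⟩ := c.step (by omega) h1 h2 (hW _ (by omega) _ h1)
    have h3 : x (v r) - b • v r = 0 := by
      refine inj c hr.le (h.mono hr.le) hb fun t ht i hi hi' => ?_
      have h4 := h.Z r hr t ht i hi hi'
      have h5 := hB ((f ^ i) (v r)) (v t)
      rw [h4, powcomm hx] at h5
      have h6 : B ((f ^ i) (x (v r))) (v t) = 0 := by
        rcases ih t ht (by omega) with h7 | h7 <;> simpa [h7] using h5
      simp [h4, h6]
    have h4 : x (v r) = b • v r := sub_eq_zero.1 h3
    have h5 := hB ((f ^ (q r)) (v r)) (v r)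
    rw [powcomm hx, h4] at h5
    have h6 : b * b = 1 := by
      simp only [map_smul, LinearMap.smul_apply, smul_eq_mul, ← mul_assoc] at h5
      exact mul_right_cancel₀ (h.C r hr) (by rw [h5, one_mul])
    rcases mul_self_eq_one_iff.1 h6 with rfl | rfl
    · left; simpa using h4
    · right; simpa using h4

theorem det [FiniteDimensional k V] (c : Ctx B f W n σ q S) {v : ℕ → V}
    (h : Good B f W q S v σ) (x x' : V ≃ₗ[k] V) (hB : ∀ u w, B (x u) (x w) = B u w)
    (hx : ∀ y, x (f y) = f (x y)) (hB' : ∀ u w, B (x' u) (x' w) = B u w)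
    (hx' : ∀ y, x' (f y) = f (x' y)) (hv : ∀ t < σ, x (v t) = x' (v t)) : x = x' := by
  have hp := powcomm (f := f) (x := (x : Module.End k V)) hx
  have hp' := powcomm (f := f) (x := (x' : Module.End k V)) hx'
  simp only [LinearEquiv.coe_coe] at hp hp'
  have hWn : ∀ w ∈ W n, x w = x' w := by
    intro w hw
    have h1 := spanW c σ le_rfl h (by rwa [c.Sn])
    refine LinearMap.eqOn_span (f := (x : V →ₗ[k] V)) (g := (x' : V →ₗ[k] V)) ?_ h1
    rintro _ ⟨⟨t, j⟩, rfl⟩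
    simp [hp, hp', hv t.1 t.2]
  ext y
  obtain ⟨e, he⟩ := x.surjective (x y - x' y)
  have he0 : e = 0 := by
    refine inj c le_rfl h ?_ ?_
    · rw [c.Sn]
      have : n = 2 * n - n := by omega
      rw [this, c.perp n le_rfl]
      intro w hw
      rw [← hB, he, map_sub, LinearMap.sub_apply, hB, hWn w hw, hB', sub_self]
    · intro t ht i _ _
      rw [← hB, hp, he, map_sub, map_sub, LinearMap.sub_apply, ← hp, hB, hv t ht, ← hp', hB',
        sub_self]
  rw [he0, map_zero] at he
  exact sub_eq_zero.1 he.symm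

theorem fin [FiniteDimensional k V] (c : Ctx B f W n σ q S) :
    {x : V ≃ₗ[k] V | (∀ u w : V, B (x u) (x w) = B u w) ∧ (∀ y : V, x (f y) = f (x y)) ∧
      (∀ i ≤ 2 * n, Submodule.map x.toLinearMap (W i) = W i)}.Finite := by
  obtain ⟨v, h⟩ := exGood c σ le_rfl
  refine Set.Finite.of_finite_image (f := fun x : V ≃ₗ[k] V => fun t : Fin σ => x (v t)) ?_ ?_
  · refine Set.Finite.subset (Set.Finite.pi' (t := fun t : Fin σ => {v t, - v t})
      fun t => Set.toFinite _) ?_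
    rintro _ ⟨x, ⟨h1, h2, h3⟩, rfl⟩ t
    refine sgn c h (x : Module.End k V) h1 h2 (fun i hi y hy => ?_) t.1 t.2
    rw [← h3 i hi]
    exact Submodule.mem_map_of_mem hy
  · rintro x ⟨h1, h2, -⟩ x' ⟨h1', h2', -⟩ hxx
    exact det c h x x' h1 h2 h1' h2' fun t ht => congrFun hxx ⟨t, ht⟩

/-- Two intersections of different dimension are separated by a vector. -/
theorem sep [FiniteDimensional k V] (g : V ≃ₗ[k] V) {X Y Y' : Submodule k V} {d : ℕ}
    (h1 : Module.finrank k ↥(Submodule.map g.toLinearMap X ⊓ Y) = d)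
    (h2 : Module.finrank k ↥(Submodule.map g.toLinearMap X ⊓ Y') = d + 1) :
    ∃ u ∈ X, g.toLinearMap u ∈ Y' ∧ g.toLinearMap u ∉ Y := by
  by_contra! hc
  have : Submodule.map g.toLinearMap X ⊓ Y' ≤ Submodule.map g.toLinearMap X ⊓ Y := by
    rintro _ ⟨⟨u, hu, rfl⟩, hy⟩
    exact ⟨⟨u, hu, rfl⟩, hc u hu hy⟩
  have := Submodule.finrank_mono this
  omega

end

end S15

/-- cf. 5.4: if `g` is an isometry of a `2n`-dimensional symplectic space `(V,B)`
such that `(g, V_*)` is in relative position `w_{p_*}` with respect to a complete isotropic flag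
`V_*`, then the group of all `x ∈ GL(V)` preserving `B`, commuting with `g` and stabilizing every
member of the flag is finite. -/
theorem stmt_15 [FiniteDimensional k V] (n σ : ℕ) (p : ℕ → ℕ)
    (hp : IsPartitionOf n σ p) (hn : 2 ≤ n)
    (B : V →ₗ[k] V →ₗ[k] k)
    (halt : ∀ x : V, B x x = 0)
    (hnd : ∀ x : V, (∀ y : V, B x y = 0) → x = 0)
    (hdim : Module.finrank k V = 2 * n)
    (W : ℕ → Submodule k V)
    (hW0 : W 0 = ⊥) (hWtop : W (2 * n) = ⊤)
    (hWmono : ∀ i j, i ≤ j → j ≤ 2 * n → W i ≤ W j)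
    (hWdim : ∀ i ≤ 2 * n, Module.finrank k ↥(W i) = i)
    (hWperp : ∀ i ≤ n, perpSub B (W i) = W (2 * n - i))
    (g : V ≃ₗ[k] V)
    (hg : ∀ x y : V, B (g x) (g y) = B x y)
    (hrel : RelPos g W σ p (2 * n)) :
    {x : V ≃ₗ[k] V |
      (∀ u w : V, B (x u) (x w) = B u w) ∧
      (∀ y : V, x (g y) = g (x y)) ∧
      (∀ i ≤ 2 * n, Submodule.map x.toLinearMap (W i) = W i)}.Finite := by
  obtain ⟨-, hp1, hp2, hp3⟩ := hp
  have c : S15.Ctx B g.toLinearMap W n σ (fun t => p (t + 1)) (partialSum p) := by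
    refine ⟨by simp [partialSum], fun r => ?_, hp3, fun r hr => hp1 _ (by simp; omega),
      fun t r htr hr => hp2 _ _ (by omega) (by omega) (by omega), hW0, hWmono, hWdim, ?_, ?_, ?_⟩
    · unfold partialSum
      rw [Finset.sum_Icc_succ_top (by omega)]
    · intro i hi y
      rw [← hWperp i hi]
      exact Iff.rfl
    · intro r hr i hi hi'
      obtain ⟨h1, h2⟩ := (hrel (r + 1) (by simp; omega)).1 i (by simp; omega)
      rw [Nat.add_sub_cancel] at h1 h2
      exact S15.sep g h1 h2
    · intro r hr
      obtain ⟨-, h1, h2⟩ := hrel (r + 1) (by simp; omega)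
      rw [Nat.add_sub_cancel] at h1 h2
      have h3 : partialSum p (r + 1) = partialSum p r + p (r + 1) := by
        unfold partialSum
        rw [Finset.sum_Icc_succ_top (by omega)]
      obtain ⟨u, hu, h4, h5⟩ := S15.sep g h1 h2
      rw [h3] at hu
      exact ⟨u, hu, h4, by rwa [Nat.sub_sub] at h5⟩
  exact S15.fin c

end
end
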